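/- The von Koch snowflake domain Ω ⊂ ℝ² satisfies the strong local β₀-shell condition with β₀ = 2 − log 4 / log 3: there is C ≥ 1 such that for all x ∈ Ω̄ and 0 < ρ ≤ r ≤ diam(Ω), m({y ∈ B(x,r) ∩ Ω : dist(y, ∂Ω) ≤ ρ}) ≤ C (ρ/r)^{β₀} m(B(x,r) ∩ Ω), and the reverse inequality m({y ∈ B(x,r) ∩ Ω : dist(y, ∂Ω) ≤ ρ}) ≥ C^{−1}(ρ/r)^{β₀} m(B(x,r) ∩ Ω) holds whenever x ∈ ∂Ω. -/

import Mathlib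

open Metric MeasureTheory

/-- Rotation by `-60°`, used to place the outward bump on a (counterclockwise
oriented) boundary segment of the snowflake. -/
noncomputable def kochRot : ℂ := Complex.exp (-(Real.pi * Complex.I) / 3)

/-- Subdivision rule of the von Koch construction: a segment `(a,b)` is replaced by
four segments of one third the length, with an outward bump in the middle. -/
noncomputable def kochSub (p : ℂ × ℂ) : List (ℂ × ℂ) :=
  let a := p.1
  let b := p.2
  let d := (b - a) / 3
  let apex := a + d + kochRot * d
  ([(a, a + d), (a + d, apex), (apex, a + 2 * d), (a + 2 * d, b)])

/-- The (counterclockwise oriented) segments of the `n`-th iteration `K_n` of the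
von Koch snowflake curve, starting from the equilateral triangle `0, 1, e^{iπ/3}`. -/
noncomputable def kochSegs : ℕ → List (ℂ × ℂ)
  | 0 => [((0:ℂ), (1:ℂ)), ((1:ℂ), Complex.exp (Real.pi * Complex.I / 3)),
      (Complex.exp (Real.pi * Complex.I / 3), (0:ℂ))]
  | n + 1 => (kochSegs n).flatMap kochSub

/-- The closed bump triangle erected (outward) on the middle third of a segment. -/
noncomputable def kochTri (p : ℂ × ℂ) : Set ℂ :=
  convexHull ℝ
    {p.1 + (p.2 - p.1) / 3,
     p.1 + (p.2 - p.1) / 3 + kochRot * ((p.2 - p.1) / 3),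
     p.1 + 2 * ((p.2 - p.1) / 3)}

/-- The closed region bounded by the von Koch snowflake curve: the initial closed
equilateral triangle together with all bump triangles of all generations. -/
noncomputable def kochRegion : Set ℂ :=
  convexHull ℝ {(0:ℂ), 1, Complex.exp (Real.pi * Complex.I / 3)} ∪
    ⋃ n : ℕ, ⋃ p ∈ kochSegs n, kochTri p

/-- The von Koch snowflake domain. -/
noncomputable def kochDomain : Set ℂ := interior kochRegion

noncomputable section
namespace KochAux

/-- First rescaled coordinate relative to the oriented segment `p`. -/
def cX (p : ℂ × ℂ) (z : ℂ) : ℝ := ((z - p.1) / (p.2 - p.1)).re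
/-- Second rescaled coordinate (positive on the right). -/
def cY (p : ℂ × ℂ) (z : ℂ) : ℝ := -(√3 * ((z - p.1) / (p.2 - p.1)).im)

/-- closed 30-30-120 triangle to the right of `p` -/
def Tc (p : ℂ × ℂ) : Set ℂ := {z | 0 ≤ cY p z ∧ cY p z ≤ cX p z ∧ cY p z ≤ 1 - cX p z}
/-- open 30-30-120 triangle to the right of `p` -/
def To (p : ℂ × ℂ) : Set ℂ := {z | 0 < cY p z ∧ cY p z < cX p z ∧ cY p z < 1 - cX p z}
/-- closed bump -/
def Bc (p : ℂ × ℂ) : Set ℂ :=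
  {z | 0 ≤ cY p z ∧ cY p z ≤ 3 * cX p z - 1 ∧ cY p z ≤ 2 - 3 * cX p z}
/-- closed equilateral triangle to the left of `p` -/
def Lc (p : ℂ × ℂ) : Set ℂ :=
  {z | cY p z ≤ 0 ∧ -cY p z ≤ 3 * cX p z ∧ -cY p z ≤ 3 * (1 - cX p z)}

lemma s3 : √3 * √3 = (3:ℝ) := Real.mul_self_sqrt (by norm_num)

lemma exp_pi3 : Complex.exp (Real.pi * Complex.I / 3) = ⟨1/2, √3/2⟩ := by
  have : (Real.pi * Complex.I / 3 : ℂ) = ((Real.pi / 3 : ℝ) : ℂ) * Complex.I := by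
    push_cast; ring
  rw [this, Complex.exp_mul_I, ← Complex.ofReal_cos, ← Complex.ofReal_sin,
    Real.cos_pi_div_three, Real.sin_pi_div_three]
  apply Complex.ext <;> simp

lemma rot_eq : kochRot = ⟨1/2, -(√3/2)⟩ := by
  have : (-(Real.pi * Complex.I) / 3 : ℂ) = ((-(Real.pi / 3) : ℝ) : ℂ) * Complex.I := by
    push_cast; ring
  rw [kochRot, this, Complex.exp_mul_I, ← Complex.ofReal_cos, ← Complex.ofReal_sin,
    Real.cos_neg, Real.sin_neg, Real.cos_pi_div_three, Real.sin_pi_div_three]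
  apply Complex.ext <;> simp

lemma rot_mul_conj : kochRot * (1 - kochRot) = 1 := by
  have := s3
  rw [rot_eq]; apply Complex.ext <;> simp <;> nlinarith

lemma conj_rot : 1 - kochRot = ⟨1/2, √3/2⟩ := by
  rw [rot_eq]; apply Complex.ext <;> simp; norm_num

lemma rot_ne : kochRot ≠ 0 := left_ne_zero_of_mul_eq_one rot_mul_conj
lemma crot_ne : 1 - kochRot ≠ 0 := right_ne_zero_of_mul_eq_one rot_mul_conj

lemma norm_rot : ‖kochRot‖ = 1 := by
  rw [kochRot]
  have : (-(Real.pi * Complex.I) / 3 : ℂ) = ((-(Real.pi / 3) : ℝ) : ℂ) * Complex.I := by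
    push_cast; ring
  rw [this, Complex.norm_exp_ofReal_mul_I]

lemma norm_crot : ‖1 - kochRot‖ = 1 := by
  have := congrArg norm rot_mul_conj
  rw [norm_mul, norm_rot] at this; simpa using this

lemma rot_inv : kochRot⁻¹ = 1 - kochRot := inv_eq_of_mul_eq_one_right rot_mul_conj
lemma crot_inv : (1 - kochRot)⁻¹ = kochRot := by rw [← rot_inv, inv_inv]

def c1 (p : ℂ × ℂ) : ℂ × ℂ := (p.1, p.1 + (p.2 - p.1) / 3)
def c2 (p : ℂ × ℂ) : ℂ × ℂ :=
  (p.1 + (p.2 - p.1) / 3, p.1 + (p.2 - p.1) / 3 + kochRot * ((p.2 - p.1) / 3))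
def c3 (p : ℂ × ℂ) : ℂ × ℂ :=
  (p.1 + (p.2 - p.1) / 3 + kochRot * ((p.2 - p.1) / 3), p.1 + 2 * ((p.2 - p.1) / 3))
def c4 (p : ℂ × ℂ) : ℂ × ℂ := (p.1 + 2 * ((p.2 - p.1) / 3), p.2)

lemma sub_eq (p : ℂ × ℂ) : kochSub p = [c1 p, c2 p, c3 p, c4 p] := rfl

lemma mem_sub {p q : ℂ × ℂ} : q ∈ kochSub p ↔ q = c1 p ∨ q = c2 p ∨ q = c3 p ∨ q = c4 p := by
  simp [sub_eq]

lemma d1 (p : ℂ × ℂ) : (c1 p).2 - (c1 p).1 = (p.2 - p.1) / 3 := by simp [c1]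
lemma d2 (p : ℂ × ℂ) : (c2 p).2 - (c2 p).1 = kochRot * ((p.2 - p.1) / 3) := by simp [c2]
lemma d3 (p : ℂ × ℂ) : (c3 p).2 - (c3 p).1 = (1 - kochRot) * ((p.2 - p.1) / 3) := by
  simp only [c3]; ring
lemma d4 (p : ℂ × ℂ) : (c4 p).2 - (c4 p).1 = (p.2 - p.1) / 3 := by simp only [c4]; ring

lemma norm_sub {p q : ℂ × ℂ} (h : q ∈ kochSub p) : ‖q.2 - q.1‖ = ‖p.2 - p.1‖ / 3 := by
  rcases mem_sub.1 h with rfl | rfl | rfl | rfl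
  · rw [d1]; simp
  · rw [d2]; simp [norm_rot]
  · rw [d3]; simp [norm_crot]
  · rw [d4]; simp

lemma q1 {p : ℂ × ℂ} (hp : p.2 - p.1 ≠ 0) (z : ℂ) : (z - (c1 p).1) / ((c1 p).2 - (c1 p).1) = 3 * ((z - p.1) / (p.2 - p.1)) := by
  rw [d1]; simp only [c1]; field_simp
lemma q4 {p : ℂ × ℂ} (hp : p.2 - p.1 ≠ 0) (z : ℂ) : (z - (c4 p).1) / ((c4 p).2 - (c4 p).1) = 3 * ((z - p.1) / (p.2 - p.1)) - 2 := by
  rw [d4]; simp only [c4]; field_simp; ring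
lemma q2 {p : ℂ × ℂ} (hp : p.2 - p.1 ≠ 0) (z : ℂ) : (z - (c2 p).1) / ((c2 p).2 - (c2 p).1) =
    (1 - kochRot) * (3 * ((z - p.1) / (p.2 - p.1)) - 1) := by
  rw [d2, ← rot_inv]; simp only [c2]
  have := rot_ne
  field_simp; ring
lemma q3 {p : ℂ × ℂ} (hp : p.2 - p.1 ≠ 0) (z : ℂ) : (z - (c3 p).1) / ((c3 p).2 - (c3 p).1) =
    kochRot * (3 * ((z - p.1) / (p.2 - p.1)) - 1 - kochRot) := by
  have h1 : (1 - kochRot) * ((p.2 - p.1) / 3) ≠ 0 :=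
    mul_ne_zero crot_ne (div_ne_zero hp (by norm_num))
  rw [d3, div_eq_iff h1]; simp only [c3]
  have ht : (z - p.1) / (p.2 - p.1) * (p.2 - p.1) = z - p.1 := div_mul_cancel₀ _ hp
  linear_combination -ht - ((3 * ((z - p.1) / (p.2 - p.1)) - 1 - kochRot) * (p.2 - p.1) / 3) *
    rot_mul_conj

lemma X1 {p : ℂ × ℂ} (hp : p.2 - p.1 ≠ 0) (z : ℂ) : cX (c1 p) z = 3 * cX p z := by
  simp only [cX, q1 hp]; simp
lemma Y1 {p : ℂ × ℂ} (hp : p.2 - p.1 ≠ 0) (z : ℂ) : cY (c1 p) z = 3 * cY p z := by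
  simp only [cY, q1 hp]; simp; ring
lemma X4 {p : ℂ × ℂ} (hp : p.2 - p.1 ≠ 0) (z : ℂ) : cX (c4 p) z = 3 * cX p z - 2 := by
  simp only [cX, q4 hp]; simp
lemma Y4 {p : ℂ × ℂ} (hp : p.2 - p.1 ≠ 0) (z : ℂ) : cY (c4 p) z = 3 * cY p z := by
  simp only [cY, q4 hp]; simp; ring
lemma X2 {p : ℂ × ℂ} (hp : p.2 - p.1 ≠ 0) (z : ℂ) : cX (c2 p) z = (3 * cX p z - 1 + 3 * cY p z) / 2 := by
  simp only [cX, cY, q2 hp, conj_rot]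
  simp; ring
lemma Y2 {p : ℂ × ℂ} (hp : p.2 - p.1 ≠ 0) (z : ℂ) : cY (c2 p) z = (3 * cY p z - 9 * cX p z + 3) / 2 := by
  simp only [cX, cY, q2 hp, conj_rot]
  simp
  linear_combination (-1/2 * (3 * ((z - p.1) / (p.2 - p.1)).re - 1)) * s3
lemma X3 {p : ℂ × ℂ} (hp : p.2 - p.1 ≠ 0) (z : ℂ) : cX (c3 p) z = 3 * (cX p z - cY p z) / 2 := by
  simp only [cX, cY, q3 hp, rot_eq]
  simp
  linear_combination (1/4) * s3
lemma Y3 {p : ℂ × ℂ} (hp : p.2 - p.1 ≠ 0) (z : ℂ) : cY (c3 p) z = (3 * cY p z + 9 * cX p z - 6) / 2 := by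
  simp only [cX, cY, q3 hp, rot_eq]
  simp
  linear_combination (3/2 * ((z - p.1) / (p.2 - p.1)).re - 1) * s3

lemma cX_combo (p : ℂ × ℂ) (z w : ℂ) {a b : ℝ} (h : a + b = 1) :
    cX p (a • z + b • w) = a * cX p z + b * cX p w := by
  have : (a • z + b • w - p.1) / (p.2 - p.1) =
      a * ((z - p.1) / (p.2 - p.1)) + b * ((w - p.1) / (p.2 - p.1)) := by
    have h' : (a : ℂ) + b = 1 := by exact_mod_cast h
    simp only [Complex.real_smul]
    linear_combination -(p.1 / (p.2 - p.1)) * (-h')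
  simp only [cX, this]; simp
lemma cY_combo (p : ℂ × ℂ) (z w : ℂ) {a b : ℝ} (h : a + b = 1) :
    cY p (a • z + b • w) = a * cY p z + b * cY p w := by
  have : (a • z + b • w - p.1) / (p.2 - p.1) =
      a * ((z - p.1) / (p.2 - p.1)) + b * ((w - p.1) / (p.2 - p.1)) := by
    have h' : (a : ℂ) + b = 1 := by exact_mod_cast h
    simp only [Complex.real_smul]
    linear_combination -(p.1 / (p.2 - p.1)) * (-h')
  simp only [cY, this]; simp; ring

lemma cX_cont (p : ℂ × ℂ) : Continuous (cX p) := by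
  unfold cX; exact Complex.continuous_re.comp (by fun_prop)
lemma cY_cont (p : ℂ × ℂ) : Continuous (cY p) := by
  unfold cY
  exact (continuous_const.mul (Complex.continuous_im.comp (by fun_prop))).neg

/-- point with prescribed coordinates -/
def pt (p : ℂ × ℂ) (x y : ℝ) : ℂ := p.1 + (p.2 - p.1) * ⟨x, -(y / √3)⟩

lemma pt_quot {p : ℂ × ℂ} (hp : p.2 - p.1 ≠ 0) (x y : ℝ) :
    (pt p x y - p.1) / (p.2 - p.1) = ⟨x, -(y / √3)⟩ := by
  simp only [pt]; field_simp; ring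
lemma cX_pt {p : ℂ × ℂ} (hp : p.2 - p.1 ≠ 0) (x y : ℝ) : cX p (pt p x y) = x := by
  simp only [cX, pt_quot hp]
lemma cY_pt {p : ℂ × ℂ} (hp : p.2 - p.1 ≠ 0) (x y : ℝ) : cY p (pt p x y) = y := by
  simp only [cY, pt_quot hp]
  have : √3 ≠ 0 := by positivity
  field_simp
lemma pt_coord {p : ℂ × ℂ} (hp : p.2 - p.1 ≠ 0) (z : ℂ) : pt p (cX p z) (cY p z) = z := by
  have : √3 ≠ 0 := by positivity
  have h : (⟨cX p z, -(cY p z / √3)⟩ : ℂ) = (z - p.1) / (p.2 - p.1) := by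
    apply Complex.ext
    · simp [cX]
    · simp only [cY]; field_simp
  rw [pt, h]; field_simp; ring
lemma pt_combo (p : ℂ × ℂ) (x y x' y' a b : ℝ) (h : a + b = 1) :
    a • pt p x y + b • pt p x' y' = pt p (a * x + b * x') (a * y + b * y') := by
  have h' : (a : ℂ) + b = 1 := by exact_mod_cast h
  have : (⟨a * x + b * x', -((a * y + b * y') / √3)⟩ : ℂ) =
    a * ⟨x, -(y/√3)⟩ + b * ⟨x', -(y'/√3)⟩ := by
    apply Complex.ext <;> simp; ring
  simp only [pt, this, Complex.real_smul]
  linear_combination p.1 * h'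

lemma quot_sub (p : ℂ × ℂ) (z w : ℂ) : (z - w) / (p.2 - p.1) =
    (z - p.1) / (p.2 - p.1) - (w - p.1) / (p.2 - p.1) := by ring

lemma dist_le {p : ℂ × ℂ} (hp : p.2 - p.1 ≠ 0) {z w : ℂ} (hx : |cX p z - cX p w| ≤ 1)
    (hy : |cY p z - cY p w| ≤ 3/2) : dist z w ≤ 2 * ‖p.2 - p.1‖ := by
  rw [dist_eq_norm]
  have h : ‖(z - w) / (p.2 - p.1)‖ ≤ 2 := by
    refine (Complex.norm_le_abs_re_add_abs_im _).trans ?_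
    rw [quot_sub, Complex.sub_re, Complex.sub_im]
    have h1 : cY p z - cY p w = -(√3 * (((z - p.1) / (p.2 - p.1)).im - ((w - p.1) / (p.2 - p.1)).im)) := by
      simp only [cY]; ring
    rw [h1, abs_neg, abs_mul, abs_of_pos (by positivity : (0:ℝ) < √3)] at hy
    have h2 : (3/2 : ℝ) ≤ √3 := by
      apply Real.le_sqrt_of_sq_le; norm_num
    have h3 := abs_nonneg (((z - p.1) / (p.2 - p.1)).im - ((w - p.1) / (p.2 - p.1)).im)
    simp only [cX] at hx
    nlinarith
  rw [norm_div, div_le_iff₀ (norm_pos_iff.2 hp)] at h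
  exact h

lemma coord_ball {p : ℂ × ℂ} (hp : p.2 - p.1 ≠ 0) {z : ℂ} {x y : ℝ}
    (hz : z ∈ ball (pt p x y) (‖p.2 - p.1‖ / 20)) : |cX p z - x| < 1/20 ∧ |cY p z - y| < 1/10 := by
  rw [mem_ball, dist_eq_norm] at hz
  have h : ‖(z - pt p x y) / (p.2 - p.1)‖ < 1/20 := by
    rw [norm_div, div_lt_iff₀ (norm_pos_iff.2 hp)]; linarith
  have h1 := (Complex.abs_re_le_norm _).trans_lt h
  have h2 := (Complex.abs_im_le_norm _).trans_lt h
  rw [quot_sub, Complex.sub_re] at h1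
  rw [quot_sub, Complex.sub_im] at h2
  constructor
  · have := cX_pt hp x y
    simp only [cX] at this
    rw [this] at h1; exact h1
  · have h3 : cY p z - y = -(√3 * (((z - p.1) / (p.2 - p.1)).im - ((pt p x y - p.1) / (p.2 - p.1)).im)) := by
      conv_lhs => rw [← cY_pt hp x y]
      simp only [cY]; ring
    rw [h3, abs_neg, abs_mul, abs_of_pos (by positivity : (0:ℝ) < √3)]
    have h4 : √3 < 2 := by
      rw [Real.sqrt_lt' (by norm_num)]; norm_num
    have h3 := abs_nonneg (((z - p.1) / (p.2 - p.1)).im - ((pt p x y - p.1) / (p.2 - p.1)).im)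
    nlinarith

lemma hull3 {s : Set ℂ} (hs : Convex ℝ s) (p : ℂ × ℂ) {x1 y1 x2 y2 x3 y3 a b c : ℝ}
    (h1 : pt p x1 y1 ∈ s) (h2 : pt p x2 y2 ∈ s) (h3 : pt p x3 y3 ∈ s)
    (ha : 0 ≤ a) (hb : 0 ≤ b) (hc : 0 ≤ c) (h : a + b + c = 1) :
    pt p (a * x1 + b * x2 + c * x3) (a * y1 + b * y2 + c * y3) ∈ s := by
  rcases eq_or_lt_of_le (add_nonneg ha hb) with h0 | h0
  · have ha0 : a = 0 := by linarith
    have hb0 : b = 0 := by linarith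
    have hc0 : c = 1 := by linarith
    subst ha0 hb0 hc0; simpa using h3
  · have e1 := hs h1 h2 (a := a / (a+b)) (b := b / (a+b)) (by positivity) (by positivity)
      (by field_simp)
    rw [pt_combo _ _ _ _ _ _ _ (by field_simp)] at e1
    have e2 := hs e1 h3 (a := a + b) (b := c) (by positivity) hc h
    rw [pt_combo _ _ _ _ _ _ _ h] at e2
    convert e2 using 2 <;> field_simp

lemma Bc_convex (p : ℂ × ℂ) : Convex ℝ (Bc p) := by
  rintro z ⟨h1, h2, h3⟩ w ⟨h4, h5, h6⟩ a b ha hb h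
  refine ⟨?_, ?_, ?_⟩ <;> rw [cY_combo p z w h] <;> try rw [cX_combo p z w h]
  · positivity
  · nlinarith
  · nlinarith
lemma Lc_convex (p : ℂ × ℂ) : Convex ℝ (Lc p) := by
  rintro z ⟨h1, h2, h3⟩ w ⟨h4, h5, h6⟩ a b ha hb h
  refine ⟨?_, ?_, ?_⟩ <;> rw [cY_combo p z w h] <;> try rw [cX_combo p z w h]
  · nlinarith
  · nlinarith
  · nlinarith
lemma Tc_convex (p : ℂ × ℂ) : Convex ℝ (Tc p) := by
  rintro z ⟨h1, h2, h3⟩ w ⟨h4, h5, h6⟩ a b ha hb h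
  refine ⟨?_, ?_, ?_⟩ <;> rw [cY_combo p z w h] <;> try rw [cX_combo p z w h]
  · positivity
  · nlinarith
  · nlinarith

lemma tri_eq {p : ℂ × ℂ} (hp : p.2 - p.1 ≠ 0) : kochTri p = Bc p := by
  have h3 : √3 ≠ 0 := by positivity
  have e1 : p.1 + (p.2 - p.1) / 3 = pt p (1/3) 0 := by
    have : (⟨1/3, -(0/√3)⟩ : ℂ) = 1/3 := by
      apply Complex.ext <;> simp
    rw [pt, this]; ring
  have e3 : p.1 + 2 * ((p.2 - p.1) / 3) = pt p (2/3) 0 := by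
    have : (⟨2/3, -(0/√3)⟩ : ℂ) = 2/3 := by
      apply Complex.ext <;> simp
    rw [pt, this]; ring
  have e2 : p.1 + (p.2 - p.1) / 3 + kochRot * ((p.2 - p.1) / 3) = pt p (1/2) (1/2) := by
    have : (⟨1/2, -(1/2/√3)⟩ : ℂ) = (1 + kochRot)/3 := by
      rw [rot_eq]
      apply Complex.ext <;> simp
      · norm_num
      · have := s3
        field_simp; linarith
    rw [pt, this]; ring
  rw [kochTri, e2, e3, e1]
  apply subset_antisymm
  · apply convexHull_min _ (Bc_convex p)
    rintro z (rfl | rfl | rfl) <;> simp only [Bc, Set.mem_ofPred_eq, cX_pt hp, cY_pt hp] <;> norm_num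
  · rintro z ⟨h1, h2, h3⟩
    have := hull3 (convex_convexHull ℝ {pt p (1/3) 0, pt p (1/2) (1/2), pt p (2/3) 0}) p
      (x1 := 1/3) (y1 := 0) (x2 := 1/2) (y2 := 1/2) (x3 := 2/3) (y3 := 0)
      (subset_convexHull _ _ (by simp)) (subset_convexHull _ _ (by simp))
      (subset_convexHull _ _ (by simp))
      (a := 2 - 3 * cX p z - cY p z) (b := 2 * cY p z) (c := 3 * cX p z - 1 - cY p z)
      (by linarith) (by linarith) (by linarith) (by ring)
    convert this
    rw [← pt_coord hp z]; rw [cX_pt hp, cY_pt hp]; congr 1 <;> ring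

abbrev p0 : ℂ × ℂ := (0, 1)
lemma p0_ne : p0.2 - p0.1 ≠ 0 := by simp

lemma T0_eq : convexHull ℝ {(0:ℂ), 1, Complex.exp (Real.pi * Complex.I / 3)} = Lc p0 := by
  have hp := p0_ne
  have h3 : √3 ≠ 0 := by positivity
  have e1 : 0 = pt p0 0 0 := by
    apply Complex.ext <;> simp [pt]
  have e2 : 1 = pt p0 1 0 := by
    apply Complex.ext <;> simp [pt]
  have e3 : Complex.exp (Real.pi * Complex.I / 3) = pt p0 (1/2) (-(3/2)) := by
    rw [exp_pi3]
    apply Complex.ext <;> simp [pt]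
    have := s3
    field_simp; linarith
  rw [e3]; nth_rewrite 1 [e1, e2]
  apply subset_antisymm
  · apply convexHull_min _ (Lc_convex p0)
    rintro z (rfl | rfl | rfl) <;> simp only [Lc, Set.mem_ofPred_eq, cX_pt hp, cY_pt hp] <;> norm_num
  · rintro z ⟨h1, h2, h3⟩
    have := hull3 (convex_convexHull ℝ {pt p0 0 0, pt p0 1 0, pt p0 (1/2) (-(3/2))}) p0
      (x1 := 0) (y1 := 0) (x2 := 1) (y2 := 0) (x3 := 1/2) (y3 := -(3/2))
      (subset_convexHull _ _ (by simp)) (subset_convexHull _ _ (by simp))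
      (subset_convexHull _ _ (by simp))
      (a := 1 - cX p0 z + cY p0 z / 3) (b := cX p0 z + cY p0 z / 3) (c := -(2/3) * cY p0 z)
      (by linarith) (by linarith) (by linarith) (by ring)
    convert this
    rw [← pt_coord hp z]; rw [cX_pt hp, cY_pt hp]; congr 1 <;> ring

abbrev pA : ℂ × ℂ := (1, Complex.exp (Real.pi * Complex.I / 3))
abbrev pB : ℂ × ℂ := (Complex.exp (Real.pi * Complex.I / 3), 0)

lemma mem_segs0 {p : ℂ × ℂ} : p ∈ kochSegs 0 ↔ p = p0 ∨ p = pA ∨ p = pB := by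
  simp [kochSegs]

lemma quotA (z : ℂ) : (z - pA.1) / (pA.2 - pA.1) = (z - 1) * ⟨-(1/2), -(√3/2)⟩ := by
  have h : (⟨1/2, √3/2⟩ - 1 : ℂ) * ⟨-(1/2), -(√3/2)⟩ = 1 := by
    have := s3
    apply Complex.ext <;> simp <;> nlinarith
  simp only [exp_pi3]
  rw [div_eq_iff (left_ne_zero_of_mul_eq_one h)]
  linear_combination -(z - 1) * h
lemma quotB (z : ℂ) : (z - pB.1) / (pB.2 - pB.1) = 1 - z * ⟨1/2, -(√3/2)⟩ := by
  have h : (⟨1/2, √3/2⟩ : ℂ) * ⟨1/2, -(√3/2)⟩ = 1 := by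
    have := s3
    apply Complex.ext <;> simp <;> nlinarith
  have h0 : (⟨1/2, √3/2⟩ : ℂ) ≠ 0 := left_ne_zero_of_mul_eq_one h
  simp only [exp_pi3]
  rw [div_eq_iff (by simpa using h0)]
  linear_combination -z * h
lemma X0 (z : ℂ) : cX p0 z = z.re := by simp [cX]
lemma Y0 (z : ℂ) : cY p0 z = -(√3 * z.im) := by simp [cY]
lemma XA (z : ℂ) : cX pA z = (1 - cX p0 z - cY p0 z) / 2 := by
  rw [X0, Y0]; rw [cX, quotA]; simp; ring
lemma YA (z : ℂ) : cY pA z = (-cY p0 z + 3 * (cX p0 z - 1)) / 2 := by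
  rw [X0, Y0]; rw [cY, quotA]; simp
  linear_combination (1/2 * (z.re - 1)) * s3
lemma XB (z : ℂ) : cX pB z = 1 - (cX p0 z - cY p0 z) / 2 := by
  rw [X0, Y0]; rw [cX, quotB]; simp; ring
lemma YB (z : ℂ) : cY pB z = -(cY p0 z + 3 * cX p0 z) / 2 := by
  rw [X0, Y0]; rw [cY, quotB]; simp
  linear_combination (-1/2 * z.re) * s3

lemma norm_w : ‖(⟨1/2, √3/2⟩ : ℂ)‖ = 1 := by rw [← conj_rot, norm_crot]

lemma norm_segs : ∀ {n : ℕ} {p : ℂ × ℂ}, p ∈ kochSegs n → ‖p.2 - p.1‖ = (1/3 : ℝ) ^ n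
  | 0, p, h => by
    rcases mem_segs0.1 h with rfl | rfl | rfl
    · simp
    · simp only [exp_pi3]
      rw [← conj_rot]; simp [norm_rot]
    · simp only [exp_pi3]; simpa using norm_w
  | n+1, p, h => by
    rw [kochSegs, List.mem_flatMap] at h
    obtain ⟨q, hq, h⟩ := h
    rw [norm_sub h, norm_segs hq]; ring

lemma segs_ne {n : ℕ} {p : ℂ × ℂ} (h : p ∈ kochSegs n) : p.2 - p.1 ≠ 0 := by
  rw [← norm_pos_iff, norm_segs h]; positivity
lemma sub_ne {p q : ℂ × ℂ} (hp : p.2 - p.1 ≠ 0) (h : q ∈ kochSub p) : q.2 - q.1 ≠ 0 := by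
  rw [← norm_pos_iff, norm_sub h]
  have := norm_pos_iff.2 hp
  positivity

def desc : ℕ → ℂ × ℂ → List (ℂ × ℂ)
  | 0, p => [p]
  | j+1, p => (kochSub p).flatMap (desc j)

lemma segs_add (j : ℕ) : ∀ k, kochSegs (k + j) = (kochSegs k).flatMap (desc j) := by
  induction j with
  | zero => intro k; simp [desc]
  | succ j ih =>
    intro k
    rw [show k + (j+1) = (k+1) + j by ring, ih, kochSegs, List.flatMap_assoc]; rfl

lemma desc_length (j : ℕ) : ∀ p, (desc j p).length = 4 ^ j := by
  induction j with
  | zero => intro p; simp [desc]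
  | succ j ih => intro p; simp [desc, sub_eq, ih]; ring

lemma Tc_sub {p q : ℂ × ℂ} (hp : p.2 - p.1 ≠ 0) (h : q ∈ kochSub p) : Tc q ⊆ Tc p := by
  rintro z ⟨h1, h2, h3⟩
  rcases mem_sub.1 h with rfl | rfl | rfl | rfl
  · rw [X1 hp, Y1 hp] at *; refine ⟨?_, ?_, ?_⟩ <;> linarith
  · rw [X2 hp, Y2 hp] at *; refine ⟨?_, ?_, ?_⟩ <;> linarith
  · rw [X3 hp, Y3 hp] at *; refine ⟨?_, ?_, ?_⟩ <;> linarith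
  · rw [X4 hp, Y4 hp] at *; refine ⟨?_, ?_, ?_⟩ <;> linarith
lemma To_sub {p q : ℂ × ℂ} (hp : p.2 - p.1 ≠ 0) (h : q ∈ kochSub p) : To q ⊆ To p := by
  rintro z ⟨h1, h2, h3⟩
  rcases mem_sub.1 h with rfl | rfl | rfl | rfl
  · rw [X1 hp, Y1 hp] at *; refine ⟨?_, ?_, ?_⟩ <;> linarith
  · rw [X2 hp, Y2 hp] at *; refine ⟨?_, ?_, ?_⟩ <;> linarith
  · rw [X3 hp, Y3 hp] at *; refine ⟨?_, ?_, ?_⟩ <;> linarith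
  · rw [X4 hp, Y4 hp] at *; refine ⟨?_, ?_, ?_⟩ <;> linarith
lemma To_Bc {p q : ℂ × ℂ} (hp : p.2 - p.1 ≠ 0) (h : q ∈ kochSub p) {z : ℂ} (hz : z ∈ To q)
    (hz' : z ∈ Bc p) : False := by
  obtain ⟨h1, h2, h3⟩ := hz
  obtain ⟨h4, h5, h6⟩ := hz'
  rcases mem_sub.1 h with rfl | rfl | rfl | rfl
  · rw [X1 hp, Y1 hp] at *; linarith
  · rw [X2 hp, Y2 hp] at *; linarith
  · rw [X3 hp, Y3 hp] at *; linarith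
  · rw [X4 hp, Y4 hp] at *; linarith

def Dj (a b : ℂ × ℂ) : Prop := (∀ z, z ∈ To a → z ∈ Tc b → False) ∧ (∀ z, z ∈ Tc a → z ∈ To b → False)

lemma To_Tc (p : ℂ × ℂ) : To p ⊆ Tc p := fun _ ⟨h1, h2, h3⟩ => ⟨h1.le, h2.le, h3.le⟩
lemma Bc_Tc (p : ℂ × ℂ) : Bc p ⊆ Tc p := by
  rintro z ⟨h1, h2, h3⟩; refine ⟨?_, ?_, ?_⟩ <;> linarith

lemma Dj_symm {a b : ℂ × ℂ} (h : Dj a b) : Dj b a :=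
  ⟨fun z h1 h2 => h.2 z h2 h1, fun z h1 h2 => h.1 z h2 h1⟩

lemma Dj_sub {p : ℂ × ℂ} (hp : p.2 - p.1 ≠ 0) : (kochSub p).Pairwise Dj := by
  rw [sub_eq]
  simp only [List.pairwise_cons, List.mem_cons, List.not_mem_nil, or_false, forall_eq_or_imp,
    forall_eq, Dj, To, Tc, Set.mem_ofPred_eq, X1 hp, X2 hp, X3 hp, X4 hp, Y1 hp, Y2 hp, Y3 hp, Y4 hp]
  refine ⟨⟨⟨?_, ?_⟩, ⟨?_, ?_⟩, ⟨?_, ?_⟩⟩, ⟨⟨?_, ?_⟩, ⟨?_, ?_⟩⟩, ⟨?_, ?_⟩, by simp, by simp⟩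
  all_goals
    rintro z ⟨h1, h2, h3⟩ ⟨h4, h5, h6⟩
    linarith

lemma Dj_segs : ∀ n, (kochSegs n).Pairwise Dj
  | 0 => by
    simp only [kochSegs, List.pairwise_cons, List.mem_cons, List.not_mem_nil, or_false,
      forall_eq_or_imp, forall_eq]
    refine ⟨⟨⟨?_, ?_⟩, ⟨?_, ?_⟩⟩, ⟨?_, ?_⟩, by simp, by simp⟩
    all_goals
      rintro z ⟨h1, h2, h3⟩ ⟨h4, h5, h6⟩
      simp only [XA, XB, YA, YB] at *
      linarith
  | n+1 => by
    rw [kochSegs, List.pairwise_flatMap]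
    refine ⟨fun a ha => Dj_sub (segs_ne ha), ?_⟩
    have h := Dj_segs n
    refine (List.Pairwise.and_mem.1 h).imp ?_
    rintro a b ⟨ha, hb, hab⟩ x hx y hy
    exact ⟨fun z h1 h2 => hab.1 z (To_sub (segs_ne ha) hx h1) (Tc_sub (segs_ne hb) hy h2),
      fun z h1 h2 => hab.2 z (Tc_sub (segs_ne ha) hx h1) (To_sub (segs_ne hb) hy h2)⟩

lemma Dj_of_ne {n : ℕ} {p q : ℂ × ℂ} (hp : p ∈ kochSegs n) (hq : q ∈ kochSegs n) (h : p ≠ q) :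
    Dj p q := by
  have : Std.Symm Dj := ⟨fun _ _ => Dj_symm⟩
  exact (Dj_segs n).forall hp hq h

lemma To_nonempty {p : ℂ × ℂ} (hp : p.2 - p.1 ≠ 0) : pt p (1/2) (1/6) ∈ To p := by
  simp only [To, Set.mem_ofPred_eq, cX_pt hp, cY_pt hp]; norm_num

lemma nodup_segs (n : ℕ) : (kochSegs n).Nodup := by
  refine (List.Pairwise.and_mem.1 (Dj_segs n)).imp ?_
  rintro a b ⟨ha, hb, hab⟩ rfl
  have := To_nonempty (segs_ne ha)
  exact hab.1 _ this (To_Tc _ this)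

lemma ball_Bc {p : ℂ × ℂ} (hp : p.2 - p.1 ≠ 0) : ball (pt p (1/2) (1/6)) (‖p.2 - p.1‖ / 20) ⊆ Bc p := by
  intro z hz
  obtain ⟨h1, h2⟩ := coord_ball hp hz
  rw [abs_lt] at h1 h2
  refine ⟨?_, ?_, ?_⟩ <;> linarith
lemma ball_To {p : ℂ × ℂ} (hp : p.2 - p.1 ≠ 0) : ball (pt p (1/2) (1/6)) (‖p.2 - p.1‖ / 20) ⊆ To p := by
  intro z hz
  obtain ⟨h1, h2⟩ := coord_ball hp hz
  rw [abs_lt] at h1 h2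
  refine ⟨?_, ?_, ?_⟩ <;> linarith
lemma ball_Lc {p : ℂ × ℂ} (hp : p.2 - p.1 ≠ 0) : ball (pt p (1/2) (-(1/2))) (‖p.2 - p.1‖ / 20) ⊆ Lc p := by
  intro z hz
  obtain ⟨h1, h2⟩ := coord_ball hp hz
  rw [abs_lt] at h1 h2
  refine ⟨?_, ?_, ?_⟩ <;> linarith

lemma desc_Tc (j : ℕ) : ∀ {p q : ℂ × ℂ}, p.2 - p.1 ≠ 0 → q ∈ desc j p → Tc q ⊆ Tc p := by
  induction j with
  | zero => intro p q hp h; simp [desc] at h; rw [h]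
  | succ j ih =>
    intro p q hp h
    rw [desc, List.mem_flatMap] at h
    obtain ⟨c, hc, h⟩ := h
    exact (ih (sub_ne hp hc) h).trans (Tc_sub hp hc)

lemma desc_ne (j : ℕ) : ∀ {p q : ℂ × ℂ}, p.2 - p.1 ≠ 0 → q ∈ desc j p → q.2 - q.1 ≠ 0 := by
  induction j with
  | zero => intro p q hp h; simp [desc] at h; rwa [h]
  | succ j ih =>
    intro p q hp h
    rw [desc, List.mem_flatMap] at h
    obtain ⟨c, hc, h⟩ := h
    exact ih (sub_ne hp hc) h

lemma mem_segs_add {k j : ℕ} {p q : ℂ × ℂ} (hp : p ∈ kochSegs k) (h : q ∈ desc j p) :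
    q ∈ kochSegs (k + j) := by
  rw [segs_add, List.mem_flatMap]; exact ⟨p, hp, h⟩

/-- all bumps generated by `p` -/
def RR (p : ℂ × ℂ) : Set ℂ := {z | ∃ j, ∃ q ∈ desc j p, z ∈ Bc q}

lemma RR_Tc {p : ℂ × ℂ} (hp : p.2 - p.1 ≠ 0) : RR p ⊆ Tc p := by
  rintro z ⟨j, q, hq, hz⟩
  exact desc_Tc j hp hq (Bc_Tc _ hz)

lemma RR_unfold {p : ℂ × ℂ} {z : ℂ} (h : z ∈ RR p) : z ∈ Bc p ∨ ∃ c ∈ kochSub p, z ∈ RR c := by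
  obtain ⟨j, q, hq, hz⟩ := h
  cases j with
  | zero => simp [desc] at hq; subst hq; exact Or.inl hz
  | succ j =>
    rw [desc, List.mem_flatMap] at hq
    obtain ⟨c, hc, h⟩ := hq
    exact Or.inr ⟨c, hc, j, q, h, hz⟩

lemma mem_region {z : ℂ} : z ∈ kochRegion ↔ z ∈ Lc p0 ∨ ∃ n, ∃ p ∈ kochSegs n, z ∈ Bc p := by
  rw [kochRegion, T0_eq, Set.mem_union]
  simp only [Set.mem_iUnion, exists_prop]
  refine or_congr Iff.rfl (exists_congr fun n => exists_congr fun p => and_congr_right fun h => ?_)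
  rw [tri_eq (segs_ne h)]

lemma To_Lc0 {p : ℂ × ℂ} (hp : p ∈ kochSegs 0) {z : ℂ} (h : z ∈ To p) (h' : z ∈ Lc p0) : False := by
  obtain ⟨h1, h2, h3⟩ := h
  obtain ⟨h4, h5, h6⟩ := h'
  rcases mem_segs0.1 hp with rfl | rfl | rfl
  · linarith
  · simp only [XA, YA] at *; linarith
  · simp only [XB, YB] at *; linarith

lemma To_region : ∀ (n : ℕ) {p : ℂ × ℂ} {z : ℂ}, p ∈ kochSegs n → z ∈ To p → z ∈ kochRegion → z ∈ RR p
  | 0, p, z, hp, hz, hR => by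
    rcases mem_region.1 hR with h | ⟨n, q, hq, h⟩
    · exact (To_Lc0 hp hz h).elim
    · rw [← zero_add n, segs_add, List.mem_flatMap] at hq
      obtain ⟨p', hp', hq⟩ := hq
      by_cases e : p = p'
      · subst e; exact ⟨n, q, hq, h⟩
      · exact ((Dj_of_ne hp hp' e).1 z hz (RR_Tc (segs_ne hp') ⟨n, q, hq, h⟩)).elim
  | n+1, p, z, hp, hz, hR => by
    have hp0 := hp
    rw [kochSegs, List.mem_flatMap] at hp
    obtain ⟨p', hp', hp⟩ := hp
    have := To_region n hp' (To_sub (segs_ne hp') hp hz) hR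
    rcases RR_unfold this with h | ⟨c, hc, h⟩
    · exact (To_Bc (segs_ne hp') hp hz h).elim
    · by_cases e : p = c
      · rwa [e]
      · have hc' : c ∈ kochSegs (n+1) := by
          rw [kochSegs, List.mem_flatMap]; exact ⟨p', hp', hc⟩
        exact ((Dj_of_ne hp0 hc' e).1 z hz (RR_Tc (segs_ne hc') h)).elim

lemma gap_To {p : ℂ × ℂ} (hp : p.2 - p.1 ≠ 0) : pt p (5/18) (1/6) ∈ To p := by
  simp only [To, Set.mem_ofPred_eq, cX_pt hp, cY_pt hp]; norm_num

lemma gap_notMem {n : ℕ} {p : ℂ × ℂ} (h : p ∈ kochSegs n) : pt p (5/18) (1/6) ∉ kochRegion := by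
  have hp := segs_ne h
  intro hR
  rcases RR_unfold (To_region n h (gap_To hp) hR) with h | ⟨c, hc, h⟩
  · simp only [Bc, Set.mem_ofPred_eq, cX_pt hp, cY_pt hp] at h; norm_num at h
  · have := RR_Tc (sub_ne hp hc) h
    rcases mem_sub.1 hc with rfl | rfl | rfl | rfl <;>
    simp only [Tc, Set.mem_ofPred_eq, X1 hp, X2 hp, X3 hp, X4 hp, Y1 hp, Y2 hp, Y3 hp, Y4 hp,
      cX_pt hp, cY_pt hp] at this <;> norm_num at this

/-- the closed polygon of level `n` -/
def P (n : ℕ) : Set ℂ := {z | z ∈ Lc p0 ∨ ∃ m < n, ∃ p ∈ kochSegs m, z ∈ Bc p}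

lemma P_mono (n : ℕ) : P n ⊆ P (n+1) := by
  rintro z (h | ⟨m, hm, h⟩)
  · exact Or.inl h
  · exact Or.inr ⟨m, hm.trans (Nat.lt_succ_self n), h⟩
lemma P_region (n : ℕ) : P n ⊆ kochRegion := by
  rintro z (h | ⟨m, hm, h⟩)
  · exact mem_region.2 (Or.inl h)
  · exact mem_region.2 (Or.inr ⟨m, h⟩)

lemma Lc_P : ∀ (n : ℕ) {p : ℂ × ℂ}, p ∈ kochSegs n → Lc p ⊆ P n
  | 0, p, hp => by
    rintro z ⟨h1, h2, h3⟩
    left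
    rcases mem_segs0.1 hp with rfl | rfl | rfl
    · exact ⟨h1, h2, h3⟩
    · rw [XA, YA] at *; refine ⟨?_, ?_, ?_⟩ <;> linarith
    · rw [XB, YB] at *; refine ⟨?_, ?_, ?_⟩ <;> linarith
  | n+1, q, hq => by
    rw [kochSegs, List.mem_flatMap] at hq
    obtain ⟨p, hp', hq⟩ := hq
    have hp := segs_ne hp'
    rintro z ⟨h1, h2, h3⟩
    rcases mem_sub.1 hq with rfl | rfl | rfl | rfl
    · rw [X1 hp, Y1 hp] at *
      apply P_mono; apply Lc_P n hp'
      refine ⟨?_, ?_, ?_⟩ <;> linarith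
    · rw [X2 hp, Y2 hp] at *
      right; refine ⟨n, n.lt_succ_self, p, hp', ?_⟩
      refine ⟨?_, ?_, ?_⟩ <;> linarith
    · rw [X3 hp, Y3 hp] at *
      right; refine ⟨n, n.lt_succ_self, p, hp', ?_⟩
      refine ⟨?_, ?_, ?_⟩ <;> linarith
    · rw [X4 hp, Y4 hp] at *
      apply P_mono; apply Lc_P n hp'
      refine ⟨?_, ?_, ?_⟩ <;> linarith

/-- the closed segment -/
def Sg (p : ℂ × ℂ) : Set ℂ := {z | cY p z = 0 ∧ 0 ≤ cX p z ∧ cX p z ≤ 1}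
lemma Sg_Tc (p : ℂ × ℂ) : Sg p ⊆ Tc p := by
  rintro z ⟨h1, h2, h3⟩; refine ⟨?_, ?_, ?_⟩ <;> linarith

lemma P_int : ∀ (n : ℕ) {z : ℂ}, z ∈ P n → z ∈ interior (P n) ∨ ∃ p ∈ kochSegs n, z ∈ Sg p
  | 0, z, hz => by
    have hz : z ∈ Lc p0 := by
      rcases hz with h | ⟨m, hm, _⟩
      · exact h
      · omega
    obtain ⟨h1, h2, h3⟩ := hz
    have cx := cX_cont p0
    have cy := cY_cont p0
    rcases h1.eq_or_lt with e1 | h1'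
    · right; refine ⟨p0, mem_segs0.2 (by simp), ?_⟩
      refine ⟨?_, ?_, ?_⟩ <;> linarith
    rcases h2.eq_or_lt with e1 | h2'
    · right; refine ⟨pB, mem_segs0.2 (by simp), ?_⟩
      simp only [Sg, Set.mem_ofPred_eq, XB, YB]
      refine ⟨?_, ?_, ?_⟩ <;> linarith
    rcases h3.eq_or_lt with e1 | h3'
    · right; refine ⟨pA, mem_segs0.2 (by simp), ?_⟩
      simp only [Sg, Set.mem_ofPred_eq, XA, YA]
      refine ⟨?_, ?_, ?_⟩ <;> linarith
    left
    rw [mem_interior_iff_mem_nhds]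
    have o1 : IsOpen {w | cY p0 w < 0} := isOpen_lt cy continuous_const
    have o2 : IsOpen {w | -cY p0 w < 3 * cX p0 w} := isOpen_lt (by fun_prop) (by fun_prop)
    have o3 : IsOpen {w | -cY p0 w < 3 * (1 - cX p0 w)} := isOpen_lt (by fun_prop) (by fun_prop)
    filter_upwards [o1.mem_nhds h1', o2.mem_nhds h2', o3.mem_nhds h3'] with w h1 h2 h3
    exact Or.inl ⟨le_of_lt h1, le_of_lt h2, le_of_lt h3⟩
  | n+1, z, hz => by
    have segcase : ∀ p ∈ kochSegs n, z ∈ Sg p →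
        z ∈ interior (P (n+1)) ∨ ∃ p ∈ kochSegs (n+1), z ∈ Sg p := by
      rintro p hp' ⟨h1, h2, h3⟩
      have hp := segs_ne hp'
      have hc : ∀ c ∈ kochSub p, c ∈ kochSegs (n+1) := fun c hc => by
        rw [kochSegs, List.mem_flatMap]; exact ⟨p, hp', hc⟩
      by_cases e1 : cX p z ≤ 1/3
      · right; refine ⟨c1 p, hc _ (by simp [mem_sub]), ?_⟩
        simp only [Sg, Set.mem_ofPred_eq, X1 hp, Y1 hp]
        refine ⟨?_, ?_, ?_⟩ <;> linarith
      by_cases e2 : 2/3 ≤ cX p z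
      · right; refine ⟨c4 p, hc _ (by simp [mem_sub]), ?_⟩
        simp only [Sg, Set.mem_ofPred_eq, X4 hp, Y4 hp]
        refine ⟨?_, ?_, ?_⟩ <;> linarith
      left
      rw [mem_interior_iff_mem_nhds]
      have cx := cX_cont p
      have cy := cY_cont p
      have o1 : IsOpen {w | cY p w < 3 * cX p w - 1} := isOpen_lt (by fun_prop) (by fun_prop)
      have o2 : IsOpen {w | -cY p w < 3 * cX p w} := isOpen_lt (by fun_prop) (by fun_prop)
      have o3 : IsOpen {w | -cY p w < 3 * (1 - cX p w)} := isOpen_lt (by fun_prop) (by fun_prop)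
      have o4 : IsOpen {w | cY p w < 2 - 3 * cX p w} := isOpen_lt (by fun_prop) (by fun_prop)
      have g1 : cY p z < 3 * cX p z - 1 := by linarith
      have g2 : -cY p z < 3 * cX p z := by linarith
      have g3 : -cY p z < 3 * (1 - cX p z) := by linarith
      have g4 : cY p z < 2 - 3 * cX p z := by linarith
      filter_upwards [o1.mem_nhds g1, o2.mem_nhds g2, o3.mem_nhds g3, o4.mem_nhds g4] with w h1 h2 h3 h4
      rcases le_total (cY p w) 0 with h | h
      · exact P_mono n (Lc_P n hp' ⟨h, le_of_lt h2, le_of_lt h3⟩)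
      · exact Or.inr ⟨n, n.lt_succ_self, p, hp', h, le_of_lt h1, le_of_lt h4⟩
    have low : z ∈ P n → z ∈ interior (P (n+1)) ∨ ∃ p ∈ kochSegs (n+1), z ∈ Sg p := fun h => by
      rcases P_int n h with h | ⟨p, hp, h⟩
      · exact Or.inl (interior_mono (P_mono n) h)
      · exact segcase p hp h
    rcases hz with h | ⟨m, hm, p, hp', h⟩
    · exact low (Or.inl h)
    rcases (Nat.lt_succ_iff.1 hm).lt_or_eq with hm | rfl
    · exact low (Or.inr ⟨m, hm, p, hp', h⟩)
    have hp := segs_ne hp'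
    have hc : ∀ c ∈ kochSub p, c ∈ kochSegs (m+1) := fun c hc => by
      rw [kochSegs, List.mem_flatMap]; exact ⟨p, hp', hc⟩
    obtain ⟨h1, h2, h3⟩ := h
    rcases h1.eq_or_lt with e1 | h1'
    · exact segcase p hp' ⟨e1.symm, by linarith, by linarith⟩
    rcases h2.eq_or_lt with e1 | h2'
    · right; refine ⟨c2 p, hc _ (by simp [mem_sub]), ?_⟩
      simp only [Sg, Set.mem_ofPred_eq, X2 hp, Y2 hp]
      refine ⟨?_, ?_, ?_⟩ <;> linarith
    rcases h3.eq_or_lt with e1 | h3'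
    · right; refine ⟨c3 p, hc _ (by simp [mem_sub]), ?_⟩
      simp only [Sg, Set.mem_ofPred_eq, X3 hp, Y3 hp]
      refine ⟨?_, ?_, ?_⟩ <;> linarith
    left
    rw [mem_interior_iff_mem_nhds]
    have cx := cX_cont p
    have cy := cY_cont p
    have o1 : IsOpen {w | 0 < cY p w} := isOpen_lt continuous_const cy
    have o2 : IsOpen {w | cY p w < 3 * cX p w - 1} := isOpen_lt (by fun_prop) (by fun_prop)
    have o3 : IsOpen {w | cY p w < 2 - 3 * cX p w} := isOpen_lt (by fun_prop) (by fun_prop)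
    filter_upwards [o1.mem_nhds h1', o2.mem_nhds h2', o3.mem_nhds h3'] with w h1 h2 h3
    exact Or.inr ⟨m, m.lt_succ_self, p, hp', le_of_lt h1, le_of_lt h2, le_of_lt h3⟩

lemma Tc_closed (p : ℂ × ℂ) : IsClosed (Tc p) := by
  have cx := cX_cont p
  have cy := cY_cont p
  have o0 : IsClosed {z | 0 ≤ cY p z} := isClosed_le (by fun_prop) (by fun_prop)
  have o1 : IsClosed {z | cY p z ≤ cX p z} := isClosed_le (by fun_prop) (by fun_prop)
  have o2 : IsClosed {z | cY p z ≤ 1 - cX p z} := isClosed_le (by fun_prop) (by fun_prop)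
  exact o0.inter (o1.inter o2)
lemma Bc_closed (p : ℂ × ℂ) : IsClosed (Bc p) := by
  have cx := cX_cont p
  have cy := cY_cont p
  have o0 : IsClosed {z | 0 ≤ cY p z} := isClosed_le (by fun_prop) (by fun_prop)
  have o1 : IsClosed {z | cY p z ≤ 3 * cX p z - 1} := isClosed_le (by fun_prop) (by fun_prop)
  have o2 : IsClosed {z | cY p z ≤ 2 - 3 * cX p z} := isClosed_le (by fun_prop) (by fun_prop)
  exact o0.inter (o1.inter o2)
lemma Lc_closed (p : ℂ × ℂ) : IsClosed (Lc p) := by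
  have cx := cX_cont p
  have cy := cY_cont p
  have o0 : IsClosed {z | cY p z ≤ 0} := isClosed_le (by fun_prop) (by fun_prop)
  have o1 : IsClosed {z | -cY p z ≤ 3 * cX p z} := isClosed_le (by fun_prop) (by fun_prop)
  have o2 : IsClosed {z | -cY p z ≤ 3 * (1 - cX p z)} := isClosed_le (by fun_prop) (by fun_prop)
  exact o0.inter (o1.inter o2)

lemma finite_mem (l : List (ℂ × ℂ)) : {p | p ∈ l}.Finite := l.finite_toSet

lemma P_closed (n : ℕ) : IsClosed (P n) := by
  have : P n = Lc p0 ∪ ⋃ m ∈ Set.Iio n, ⋃ p ∈ {p | p ∈ kochSegs m}, Bc p := by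
    ext z; simp [P]
  rw [this]
  refine (Lc_closed _).union ((Set.finite_Iio n).isClosed_biUnion fun m _ => ?_)
  exact (finite_mem _).isClosed_biUnion fun p _ => Bc_closed p

def TT (n : ℕ) : Set ℂ := ⋃ p ∈ {p | p ∈ kochSegs n}, Tc p
lemma TT_closed (n : ℕ) : IsClosed (TT n) := (finite_mem _).isClosed_biUnion fun p _ => Tc_closed p
lemma mem_TT {n : ℕ} {z : ℂ} : z ∈ TT n ↔ ∃ p ∈ kochSegs n, z ∈ Tc p := by simp [TT]

lemma region_sub (n : ℕ) : kochRegion ⊆ P n ∪ TT n := by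
  intro z hz
  rcases mem_region.1 hz with h | ⟨m, q, hq, h⟩
  · exact Or.inl (Or.inl h)
  · by_cases hm : m < n
    · exact Or.inl (Or.inr ⟨m, hm, q, hq, h⟩)
    · obtain ⟨j, rfl⟩ := Nat.exists_eq_add_of_le (not_lt.1 hm)
      rw [segs_add, List.mem_flatMap] at hq
      obtain ⟨p, hp, hq⟩ := hq
      exact Or.inr (mem_TT.2 ⟨p, hp, desc_Tc j (segs_ne hp) hq (Bc_Tc _ h)⟩)

lemma closure_sub (n : ℕ) : closure kochDomain ⊆ P n ∪ TT n :=
  closure_minimal (interior_subset.trans (region_sub n)) ((P_closed n).union (TT_closed n))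

lemma frontier_sub (n : ℕ) {z : ℂ} (hz : z ∈ frontier kochDomain) : ∃ p ∈ kochSegs n, z ∈ Tc p := by
  have ho : IsOpen kochDomain := isOpen_interior
  rw [ho.frontier_eq] at hz
  rcases closure_sub n hz.1 with h | h
  · rcases P_int n h with h | ⟨p, hp, h⟩
    · exact (hz.2 (interior_mono (P_region n) h)).elim
    · exact ⟨p, hp, Sg_Tc p h⟩
  · exact mem_TT.1 h

lemma Tc_dist {p : ℂ × ℂ} (hp : p.2 - p.1 ≠ 0) {z w : ℂ} (hz : z ∈ Tc p) (hw : w ∈ Tc p) :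
    dist z w ≤ 2 * ‖p.2 - p.1‖ := by
  obtain ⟨h1, h2, h3⟩ := hz
  obtain ⟨h4, h5, h6⟩ := hw
  apply dist_le hp <;> rw [abs_le] <;> constructor <;> linarith
lemma Lc_dist {p : ℂ × ℂ} (hp : p.2 - p.1 ≠ 0) {z w : ℂ} (hz : z ∈ Lc p) (hw : w ∈ Lc p) :
    dist z w ≤ 2 * ‖p.2 - p.1‖ := by
  obtain ⟨h1, h2, h3⟩ := hz
  obtain ⟨h4, h5, h6⟩ := hw
  apply dist_le hp <;> rw [abs_le] <;> constructor <;> linarith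
lemma fst_Tc (p : ℂ × ℂ) : p.1 ∈ Tc p := by simp [Tc, cX, cY]
lemma fst_Lc (p : ℂ × ℂ) : p.1 ∈ Lc p := by simp [Lc, cX, cY]

lemma region_norm {z : ℂ} (hz : z ∈ kochRegion) : dist z 0 ≤ 4 := by
  have L0 : ∀ w ∈ P 0, dist w 0 ≤ 2 := fun w hw => by
    have : w ∈ Lc p0 := by
      rcases hw with h | ⟨m, hm, _⟩
      · exact h
      · omega
    have := Lc_dist p0_ne this (fst_Lc p0)
    simpa using this
  rcases region_sub 0 hz with h | h
  · linarith [L0 z h]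
  · obtain ⟨p, hp, h⟩ := mem_TT.1 h
    have h1 := Tc_dist (segs_ne hp) h (fst_Tc p)
    rw [norm_segs hp] at h1
    have h2 := L0 _ (Lc_P 0 hp (fst_Lc p))
    have := dist_triangle z p.1 0
    norm_num at h1
    linarith

lemma diam_le : diam kochDomain ≤ 8 := by
  apply diam_le_of_forall_dist_le (by norm_num)
  intro x hx y hy
  have h1 := region_norm (interior_subset hx)
  have h2 := region_norm (interior_subset hy)
  have := dist_triangle_right x y 0
  linarith

/-- ball of radius `‖p‖/20` inside the bump -/
def bb (p : ℂ × ℂ) : Set ℂ := ball (pt p (1/2) (1/6)) (‖p.2 - p.1‖ / 20)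

lemma bb_domain {n : ℕ} {p : ℂ × ℂ} (hp : p ∈ kochSegs n) : bb p ⊆ kochDomain :=
  interior_maximal ((ball_Bc (segs_ne hp)).trans fun _ hz => mem_region.2 (Or.inr ⟨n, p, hp, hz⟩))
    isOpen_ball

lemma exists_frontier {n : ℕ} {p : ℂ × ℂ} (hp : p ∈ kochSegs n) {y : ℂ} (hy : y ∈ bb p) :
    ∃ w ∈ frontier kochDomain, w ∈ Tc p := by
  have hne := segs_ne hp
  have h : (Tc p ∩ frontier kochDomain).Nonempty := by
    by_contra hcon
    rw [Set.not_nonempty_iff_eq_empty] at hcon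
    have ho : IsOpen kochDomain := isOpen_interior
    have a1 : Tc p ⊆ kochDomain ∪ (closure kochDomain)ᶜ := by
      intro w hw
      by_cases h1 : w ∈ kochDomain
      · exact Or.inl h1
      · right; intro h2
        have : w ∈ Tc p ∩ frontier kochDomain := ⟨hw, by rw [ho.frontier_eq]; exact ⟨h2, h1⟩⟩
        rw [hcon] at this; exact this
    have a2 : (Tc p ∩ kochDomain).Nonempty := ⟨y, To_Tc p (ball_To hne hy), bb_domain hp hy⟩
    have a3 : (Tc p ∩ (closure kochDomain)ᶜ).Nonempty := by
      refine ⟨_, To_Tc p (gap_To hne), fun h => ?_⟩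
      have : pt p (5/18) (1/6) ∈ Tc p ∩ frontier kochDomain := ⟨To_Tc p (gap_To hne), by
        rw [ho.frontier_eq]; exact ⟨h, fun h => gap_notMem hp (interior_subset h)⟩⟩
      rw [hcon] at this; exact this
    obtain ⟨w, hw, h1, h2⟩ := (Tc_convex p).isPreconnected kochDomain (closure kochDomain)ᶜ ho
      isClosed_closure.isOpen_compl a1 a2 a3
    exact h2 (subset_closure h1)
  obtain ⟨w, h1, h2⟩ := h
  exact ⟨w, h2, h1⟩

lemma vb (a : ℂ) {r : ℝ} (hr : 0 ≤ r) : volume (ball a r) = ENNReal.ofReal (Real.pi * r ^ 2) := by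
  rw [Complex.volume_ball, mul_comm, ENNReal.ofReal_mul Real.pi_pos.le, ENNReal.ofReal_pow hr]
  congr 1
  exact (ENNReal.ofReal_eq_coe_nnreal Real.pi_pos.le).symm
lemma vcb (a : ℂ) {r : ℝ} (hr : 0 ≤ r) :
    volume (closedBall a r) = ENNReal.ofReal (Real.pi * r ^ 2) := by
  rw [Complex.volume_closedBall, mul_comm, ENNReal.ofReal_mul Real.pi_pos.le, ENNReal.ofReal_pow hr]
  congr 1
  exact (ENNReal.ofReal_eq_coe_nnreal Real.pi_pos.le).symm

lemma homothety {K : Set ℂ} (hK : Convex ℝ K) (hKR : K ⊆ kochRegion) {x c : ℂ} (hx : x ∈ K)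
    {t M l r : ℝ} (hc : ball c t ⊆ K) (hM : ∀ z ∈ K, dist z x ≤ M) (hl : 0 < l) (hl1 : l ≤ 1)
    (hr : l * M < r) : ball (x + l • (c - x)) (l * t) ⊆ ball x r ∩ kochDomain := by
  have key : ∀ y ∈ ball (x + l • (c - x)) (l * t), ∃ z ∈ K, y = x + l • (z - x) := by
    intro y hy
    refine ⟨x + l⁻¹ • (y - x), hc ?_, ?_⟩
    · rw [mem_ball, dist_eq_norm] at *
      have : y - (x + l • (c - x)) = l • (x + l⁻¹ • (y - x) - c) := by
        simp only [smul_sub, smul_add, smul_inv_smul₀ hl.ne']; abel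
      rw [this, norm_smul, Real.norm_of_nonneg hl.le] at hy
      exact lt_of_mul_lt_mul_left hy hl.le
    · rw [add_sub_cancel_left, smul_inv_smul₀ hl.ne']; abel
  apply Set.subset_inter
  · intro y hy
    obtain ⟨z, hz, rfl⟩ := key y hy
    have := hM z hz
    rw [dist_eq_norm] at this
    rw [mem_ball, dist_eq_norm, add_sub_cancel_left, norm_smul, Real.norm_of_nonneg hl.le]
    exact (mul_le_mul_of_nonneg_left this hl.le).trans_lt hr
  · apply interior_maximal _ isOpen_ball
    intro y hy
    obtain ⟨z, hz, rfl⟩ := key y hy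
    apply hKR
    have := hK hx hz (a := 1 - l) (b := l) (by linarith) hl.le (by ring)
    convert this using 1
    simp only [smul_sub, sub_smul, one_smul]; abel

lemma density {x : ℂ} (hx : x ∈ closure kochDomain) (k : ℕ) {r : ℝ} (hr : 2 * (1/3 : ℝ) ^ k < r) :
    ENNReal.ofReal (Real.pi * ((1/3 : ℝ) ^ k / 20) ^ 2) ≤ volume (ball x r ∩ kochDomain) := by
  suffices h : ∃ c, ball c ((1/3 : ℝ) ^ k / 20) ⊆ ball x r ∩ kochDomain by
    obtain ⟨c, h⟩ := h
    rw [← vb c (by positivity)]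
    exact measure_mono h
  rcases closure_sub k hx with (h | ⟨m, hm, p, hp, h⟩) | h
  · have := homothety (Lc_convex p0) (fun z hz => mem_region.2 (Or.inl hz)) h (ball_Lc p0_ne)
      (fun z hz => Lc_dist p0_ne hz h) (l := (1/3 : ℝ) ^ k) (by positivity)
      (pow_le_one₀ (by norm_num) (by norm_num)) (r := r) (by simpa [mul_comm] using hr)
    refine ⟨_, subset_trans (ball_subset_ball (le_of_eq ?_)) this⟩
    simp; ring
  · obtain ⟨j, rfl⟩ := Nat.exists_eq_add_of_lt hm
    have hne := segs_ne hp
    have e : (1/3 : ℝ) ^ (j+1) * (1/3) ^ m = (1/3) ^ (m + j + 1) := by ring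
    have := homothety (Bc_convex p) (fun z hz => mem_region.2 (Or.inr ⟨m, p, hp, hz⟩)) h (ball_Bc hne)
      (fun z hz => Tc_dist hne (Bc_Tc _ hz) (Bc_Tc _ h)) (l := (1/3 : ℝ) ^ (j + 1)) (by positivity)
      (pow_le_one₀ (by norm_num) (by norm_num)) (r := r) (by rw [norm_segs hp]; linarith)
    refine ⟨_, subset_trans (ball_subset_ball (le_of_eq ?_)) this⟩
    rw [norm_segs hp]; linarith
  · obtain ⟨p, hp, h⟩ := mem_TT.1 h
    have hne := segs_ne hp
    refine ⟨pt p (1/2) (1/6), Set.subset_inter ?_ ?_⟩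
    · intro y hy
      rw [← norm_segs hp] at hy
      have := Tc_dist hne (To_Tc _ (ball_To hne hy)) h
      rw [norm_segs hp] at this
      exact this.trans_lt hr
    · rw [← norm_segs hp]; exact bb_domain hp

lemma vol_bb {n : ℕ} {p : ℂ × ℂ} (hp : p ∈ kochSegs n) :
    volume (bb p) = ENNReal.ofReal (Real.pi * ((1/3 : ℝ) ^ n / 20) ^ 2) := by
  rw [bb, norm_segs hp, vb _ (by positivity)]

lemma bb_disj {n : ℕ} {p q : ℂ × ℂ} (hp : p ∈ kochSegs n) (hq : q ∈ kochSegs n) (h : p ≠ q) :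
    Disjoint (bb p) (bb q) := by
  rw [Set.disjoint_left]
  intro z h1 h2
  exact (Dj_of_ne hp hq h).1 z (ball_To (segs_ne hp) h1) (To_Tc _ (ball_To (segs_ne hq) h2))

lemma sum_bb {n : ℕ} (A : Finset (ℂ × ℂ)) (hA : ∀ p ∈ A, p ∈ kochSegs n) :
    volume (⋃ p ∈ A, bb p) = A.card * ENNReal.ofReal (Real.pi * ((1/3 : ℝ) ^ n / 20) ^ 2) := by
  rw [measure_biUnion_finset (fun p hp q hq h => bb_disj (hA p hp) (hA q hq) h)
    (fun p _ => measurableSet_ball), Finset.sum_congr rfl (fun p hp => vol_bb (hA p hp))]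
  simp

lemma count (x : ℂ) (k : ℕ) (A : Finset (ℂ × ℂ)) (hA : ∀ p ∈ A, p ∈ kochSegs k)
    (hx : ∀ p ∈ A, dist p.1 x ≤ 29 * (1/3 : ℝ) ^ k) : (A.card : ℝ) ≤ 409600 := by
  have h1 : (⋃ p ∈ A, bb p) ⊆ ball x (32 * (1/3 : ℝ) ^ k) := by
    intro y hy
    simp only [Set.mem_iUnion, exists_prop] at hy
    obtain ⟨p, hp, hy⟩ := hy
    have hs := hA p hp
    have h1 := Tc_dist (segs_ne hs) (To_Tc _ (ball_To (segs_ne hs) hy)) (fst_Tc p)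
    rw [norm_segs hs] at h1
    have h2 := hx p hp
    have h3 := dist_triangle y p.1 x
    have : (0:ℝ) < (1/3) ^ k := by positivity
    rw [mem_ball]; linarith
  have h2 := measure_mono (μ := volume) h1
  have hs : (0:ℝ) < (1/3) ^ k := by positivity
  rw [sum_bb A hA, vb _ (by positivity), ← ENNReal.ofReal_natCast,
    ← ENNReal.ofReal_mul (by positivity), ENNReal.ofReal_le_ofReal_iff (by positivity)] at h2
  have h3 : (0:ℝ) < Real.pi * ((1/3) ^ k) ^ 2 := by positivity
  have h4 : (A.card : ℝ) * (Real.pi * ((1/3) ^ k) ^ 2) ≤ 409600 * (Real.pi * ((1/3) ^ k) ^ 2) := by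
    nlinarith
  exact le_of_mul_le_mul_right h4 h3

lemma frontier_ne : (frontier kochDomain).Nonempty := by
  obtain ⟨w, h, _⟩ := exists_frontier (mem_segs0.2 (Or.inl rfl))
    (y := pt p0 (1/2) (1/6)) (mem_ball_self (by simp))
  exact ⟨w, h⟩

lemma upper {x : ℂ} (k j : ℕ) {r ρ : ℝ} (hρr : ρ ≤ r) (hρ : 0 < ρ)
    (hr : r ≤ 9 * (1/3 : ℝ) ^ k)
    (hn : 3 * (1/3 : ℝ) ^ (k+j) < ρ) (hn' : ρ ≤ 9 * (1/3 : ℝ) ^ (k+j)) :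
    volume {y | y ∈ ball x r ∩ kochDomain ∧ infDist y (frontier kochDomain) ≤ ρ} ≤
      ENNReal.ofReal (409600 * 4 ^ j * (Real.pi * (27 * (1/3 : ℝ) ^ (k+j)) ^ 2)) := by
  classical
  set A := (kochSegs k).toFinset.filter (fun p => dist p.1 x ≤ 29 * (1/3 : ℝ) ^ k) with hA
  have hsub : {y | y ∈ ball x r ∩ kochDomain ∧ infDist y (frontier kochDomain) ≤ ρ} ⊆
      ⋃ p ∈ A, ⋃ q ∈ (desc j p).toFinset, closedBall q.1 (27 * (1/3 : ℝ) ^ (k+j)) := by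
    rintro y ⟨⟨hy, -⟩, hd⟩
    rw [mem_ball] at hy
    obtain ⟨w, hw, hyw⟩ := (infDist_lt_iff frontier_ne).1 (hd.trans_lt (by linarith : ρ < 2 * ρ))
    obtain ⟨q, hq, hwq⟩ := frontier_sub (k+j) hw
    have h1 := Tc_dist (segs_ne hq) hwq (fst_Tc q)
    rw [norm_segs hq] at h1
    rw [segs_add, List.mem_flatMap] at hq
    obtain ⟨p, hp, hq⟩ := hq
    have h2 := Tc_dist (segs_ne hp) (desc_Tc j (segs_ne hp) hq hwq) (fst_Tc p)
    rw [norm_segs hp] at h2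
    simp only [Set.mem_iUnion, exists_prop]
    refine ⟨p, ?_, q, List.mem_toFinset.2 hq, ?_⟩
    · rw [hA, Finset.mem_filter]
      refine ⟨List.mem_toFinset.2 hp, ?_⟩
      have := dist_triangle4_left p.1 x w y
      have e1 := dist_comm p.1 w
      have e2 := dist_triangle p.1 w x
      have e3 := dist_triangle w y x
      rw [dist_comm w y] at e3
      linarith
    · rw [mem_closedBall]
      have := dist_triangle y w q.1
      linarith
  have hcard := count x k A (fun p hp => List.mem_toFinset.1 (Finset.mem_filter.1 hp).1)
    (fun p hp => (Finset.mem_filter.1 hp).2)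
  refine (measure_mono hsub).trans ?_
  have inner : ∀ p ∈ A, volume (⋃ q ∈ (desc j p).toFinset, closedBall q.1 (27 * (1/3 : ℝ) ^ (k+j))) ≤
      ENNReal.ofReal (4 ^ j * (Real.pi * (27 * (1/3 : ℝ) ^ (k+j)) ^ 2)) := by
    intro p _
    refine (measure_biUnion_finset_le _ _).trans ?_
    rw [Finset.sum_congr rfl (fun q _ => vcb q.1 (by positivity)), Finset.sum_const, nsmul_eq_mul,
      ← ENNReal.ofReal_natCast, ← ENNReal.ofReal_mul (by positivity)]
    apply ENNReal.ofReal_le_ofReal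
    gcongr
    have := List.toFinset_card_le (desc j p)
    rw [desc_length] at this
    exact_mod_cast this
  refine (measure_biUnion_finset_le _ _).trans ((Finset.sum_le_sum inner).trans ?_)
  rw [Finset.sum_const, nsmul_eq_mul, ← ENNReal.ofReal_natCast,
    ← ENNReal.ofReal_mul (by positivity), mul_assoc]
  apply ENNReal.ofReal_le_ofReal
  gcongr

lemma lower {x : ℂ} (hx : x ∈ frontier kochDomain) (k j : ℕ) {r ρ : ℝ}
    (hr : 2 * (1/3 : ℝ) ^ k < r) (hn : 2 * (1/3 : ℝ) ^ (k+j) ≤ ρ) :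
    ENNReal.ofReal (4 ^ j * (Real.pi * ((1/3 : ℝ) ^ (k+j) / 20) ^ 2)) ≤
    volume {y | y ∈ ball x r ∩ kochDomain ∧ infDist y (frontier kochDomain) ≤ ρ} := by
  classical
  obtain ⟨p, hp, hxp⟩ := frontier_sub k hx
  have hnd : (desc j p).Nodup := by
    have := nodup_segs (k+j)
    rw [segs_add, List.nodup_flatMap] at this
    exact this.1 p hp
  have h1 := sum_bb (n := k+j) (desc j p).toFinset
    (fun q hq => mem_segs_add hp (List.mem_toFinset.1 hq))
  rw [List.toFinset_card_of_nodup hnd, desc_length, ← ENNReal.ofReal_natCast,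
    ← ENNReal.ofReal_mul (by positivity)] at h1
  push_cast at h1
  rw [← h1]
  apply measure_mono
  intro y hy
  simp only [Set.mem_iUnion, exists_prop, List.mem_toFinset] at hy
  obtain ⟨q, hq, hy⟩ := hy
  have hqs := mem_segs_add hp hq
  have hyT : y ∈ Tc q := To_Tc _ (ball_To (segs_ne hqs) hy)
  refine ⟨⟨?_, bb_domain hqs hy⟩, ?_⟩
  · have := Tc_dist (segs_ne hp) (desc_Tc j (segs_ne hp) hq hyT) hxp
    rw [norm_segs hp] at this
    exact this.trans_lt hr
  · obtain ⟨w, hw, hwT⟩ := exists_frontier hqs hy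
    have := Tc_dist (segs_ne hqs) hyT hwT
    rw [norm_segs hqs] at this
    exact (infDist_le_dist_of_mem hw).trans (this.trans hn)

lemma three_beta : (3:ℝ) ^ (2 - Real.log 4 / Real.log 3) = 9 / 4 := by
  have h : (3:ℝ) ^ (Real.log 4 / Real.log 3) = 4 := by
    have h3 : Real.log 3 ≠ 0 := (Real.log_pos (by norm_num)).ne'
    rw [Real.rpow_def_of_pos (by norm_num), mul_div_cancel₀ _ h3, Real.exp_log (by norm_num)]
  rw [Real.rpow_sub (by norm_num), h]; norm_num

lemma beta_pos : 0 ≤ 2 - Real.log 4 / Real.log 3 := by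
  have h3 : 0 < Real.log 3 := Real.log_pos (by norm_num)
  have : Real.log 4 / Real.log 3 ≤ 2 := by
    rw [div_le_iff₀ h3]
    have : (2:ℝ) * Real.log 3 = Real.log (3^2) := by rw [Real.log_pow]; norm_num
    rw [this]
    exact Real.log_le_log (by norm_num) (by norm_num)
  linarith

lemma third_beta (j : ℕ) : ((1/3 : ℝ) ^ j) ^ (2 - Real.log 4 / Real.log 3) = (4/9) ^ j := by
  rw [← Real.rpow_natCast_mul (by norm_num), mul_comm, Real.rpow_mul_natCast (by norm_num), one_div,
    Real.inv_rpow (by norm_num), three_beta]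
  norm_num

end KochAux
end

/-- The von Koch snowflake domain satisfies the strong local `β₀`-shell condition
with `β₀ = 2 - log 4 / log 3`. -/
theorem stmt11 :
    ∃ C : ℝ, 1 ≤ C ∧
      ∀ x ∈ closure kochDomain, ∀ ρ r : ℝ, 0 < ρ → ρ ≤ r → r ≤ diam kochDomain →
        volume {y | y ∈ ball x r ∩ kochDomain ∧ infDist y (frontier kochDomain) ≤ ρ} ≤
          ENNReal.ofReal (C * (ρ / r) ^ (2 - Real.log 4 / Real.log 3)) *
            volume (ball x r ∩ kochDomain) ∧
        (x ∈ frontier kochDomain →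
          ENNReal.ofReal (C⁻¹ * (ρ / r) ^ (2 - Real.log 4 / Real.log 3)) *
              volume (ball x r ∩ kochDomain) ≤
            volume {y | y ∈ ball x r ∩ kochDomain ∧
              infDist y (frontier kochDomain) ≤ ρ}) := by
  refine ⟨10 ^ 12, by norm_num, ?_⟩
  intro x hx ρ r hρ hρr hrd
  have hr8 := hrd.trans KochAux.diam_le
  have hr : 0 < r := hρ.trans_le hρr
  obtain ⟨k, hk1, hk2⟩ := exists_nat_pow_near_of_lt_one (x := r / 9) (y := (1/3 : ℝ)) (by positivity)
    (by linarith) (by norm_num) (by norm_num)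
  obtain ⟨n, hn1, hn2⟩ := exists_nat_pow_near_of_lt_one (x := ρ / 9) (y := (1/3 : ℝ)) (by positivity)
    (by linarith) (by norm_num) (by norm_num)
  have hkn : k ≤ n := by
    by_contra hcon
    have h1 : (1/3 : ℝ) ^ k ≤ (1/3) ^ (n+1) :=
      pow_le_pow_of_le_one (by norm_num) (by norm_num) (by omega)
    linarith
  obtain ⟨j, rfl⟩ := Nat.exists_eq_add_of_le hkn
  rw [pow_succ] at hk1 hn1
  set β := 2 - Real.log 4 / Real.log 3 with hβ
  have hs : (0:ℝ) < (1/3) ^ k := by positivity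
  have ht : (0:ℝ) < (1/3) ^ j := by positivity
  have hst : (1/3 : ℝ) ^ (k+j) = (1/3) ^ k * (1/3) ^ j := pow_add _ _ _
  have h49 : (4/9 : ℝ) ^ j = 4 ^ j * ((1/3 : ℝ) ^ j) ^ 2 := by
    rw [← pow_mul, mul_comm j 2, pow_mul, ← mul_pow]; norm_num
  have hq0 : 0 < ρ / r := by positivity
  have q1 : ρ / r ≤ 3 * (1/3 : ℝ) ^ j := by
    rw [div_le_iff₀ hr]; rw [hst] at hn1 hn2; nlinarith [mul_lt_mul_of_pos_right hk1 ht]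
  have q2 : (1/3 : ℝ) ^ j ≤ 3 * (ρ / r) := by
    rw [← mul_div_assoc, le_div_iff₀ hr]; rw [hst] at hn1 hn2; nlinarith [mul_le_mul_of_nonneg_right hk2 ht.le]
  have b1 : (ρ / r) ^ β ≤ 9/4 * (4/9) ^ j := by
    have := Real.rpow_le_rpow hq0.le q1 KochAux.beta_pos
    rwa [Real.mul_rpow (by norm_num) ht.le, KochAux.three_beta, KochAux.third_beta] at this
  have b2 : (4/9) ^ j ≤ 9/4 * (ρ / r) ^ β := by
    have := Real.rpow_le_rpow ht.le q2 KochAux.beta_pos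
    rwa [Real.mul_rpow (by norm_num) hq0.le, KochAux.three_beta, KochAux.third_beta] at this
  have hb0 : 0 < (ρ / r) ^ β := Real.rpow_pos_of_pos hq0 _
  have h490 : (0:ℝ) < (4/9) ^ j := by positivity
  have hpi := Real.pi_pos
  constructor
  · refine (KochAux.upper k j hρr hρ (by linarith) (by linarith) (by linarith)).trans ?_
    refine le_trans ?_ (mul_le_mul_right (KochAux.density hx k (r := r) (by linarith)) _)
    rw [← ENNReal.ofReal_mul (by positivity)]
    apply ENNReal.ofReal_le_ofReal
    have e1 : 409600 * 4 ^ j * (Real.pi * (27 * (1/3 : ℝ) ^ (k+j)) ^ 2) =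
        (409600 * 729) * (4/9) ^ j * (Real.pi * ((1/3) ^ k) ^ 2) := by
      rw [h49, hst]; ring
    have e2 : 10 ^ 12 * (ρ / r) ^ β * (Real.pi * ((1/3 : ℝ) ^ k / 20) ^ 2) =
        (10 ^ 12 / 400) * (ρ / r) ^ β * (Real.pi * ((1/3) ^ k) ^ 2) := by ring
    rw [e1, e2]
    apply mul_le_mul_of_nonneg_right _ (by positivity)
    linarith
  · intro hxf
    refine le_trans ?_ (KochAux.lower hxf k j (by linarith) (by linarith))
    refine (mul_le_mul_right (measure_mono Set.inter_subset_left) _).trans ?_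
    rw [KochAux.vb _ hr.le, ← ENNReal.ofReal_mul (by positivity)]
    apply ENNReal.ofReal_le_ofReal
    have e1 : 4 ^ j * (Real.pi * ((1/3 : ℝ) ^ (k+j) / 20) ^ 2) =
        (4/9) ^ j / 400 * (Real.pi * ((1/3) ^ k) ^ 2) := by
      rw [h49, hst]; ring
    have e2 : Real.pi * r ^ 2 ≤ 81 * (Real.pi * ((1/3) ^ k) ^ 2) := by
      have : r ^ 2 ≤ (9 * (1/3) ^ k) ^ 2 := pow_le_pow_left₀ hr.le (by linarith) 2
      nlinarith
    rw [e1]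
    calc _ ≤ (10 ^ 12)⁻¹ * (ρ / r) ^ β * (81 * (Real.pi * ((1/3) ^ k) ^ 2)) := by gcongr
      _ = ((10 ^ 12)⁻¹ * 81) * (ρ / r) ^ β * (Real.pi * ((1/3) ^ k) ^ 2) := by ring
      _ ≤ _ := by
        apply mul_le_mul_of_nonneg_right _ (by positivity)
        linarith
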